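/- Let (V, {f_{il}}) be a weak lower perfect space over k with a lower perfect basis B. Then the restriction of the canonical projection p_H : V → V_H to the highest core B_H is injective. -/

import Mathlib

open Function

/-- A weak lower perfect space: a `P`-graded `k`-vector space `V = ⊕_{μ ∈ P} V_μ`
with endomorphisms `f il` for `(i,l) ∈ I^∞ = I × ℤ_{>0}`. -/
structure WeakLowerPerfectSpace (k I P V : Type*) [Field k] [AddCommGroup P]
    [AddCommGroup V] [Module k V] where
  /-- the simple roots `α_i` -/
  alpha : I → P
  alpha_indep : LinearIndependent ℤ alpha
  /-- `P` is a free abelian group -/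
  free : Module.Free ℤ P
  /-- the weight spaces `V_μ` -/
  weight : P → Submodule k V
  weight_indep : iSupIndep weight
  weight_sup : ⨆ μ : P, weight μ = ⊤
  /-- the endomorphisms `f_{il}` -/
  f : I × ℕ+ → Module.End k V
  finiteDim : ∀ μ : P, Module.Finite k (weight μ)
  support_bounded : ∃ s : Finset P, ∀ μ : P, weight μ ≠ ⊥ →
    ∃ lam ∈ s, lam - μ ∈ AddSubmonoid.closure (Set.range alpha)
  f_weight : ∀ (i : I) (l : ℕ+) (μ : P),
    (weight μ).map (f (i, l)) ≤ weight (μ - (l : ℕ) • alpha i)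

namespace WeakLowerPerfectSpace

variable {k I P V : Type*} [Field k] [AddCommGroup P] [AddCommGroup V] [Module k V]

/-- `d il v` is the unique `n` with `v ∈ f_{il}^n V \ f_{il}^{n+1} V` (for `v ≠ 0`),
realized as the largest `n` with `v ∈ f_{il}^n V`. -/
noncomputable def d (S : WeakLowerPerfectSpace k I P V) (il : I × ℕ+) (v : V) : ℕ :=
  sSup {n : ℕ | v ∈ LinearMap.range (S.f il ^ n)}

end WeakLowerPerfectSpace

/-- A lower perfect basis `B` of a weak lower perfect space, with structure maps
`F il : B → B ∪ {0}` (extended by `F il 0 = 0`). -/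
structure LowerPerfectBasis {k I P V : Type*} [Field k] [AddCommGroup P]
    [AddCommGroup V] [Module k V] (S : WeakLowerPerfectSpace k I P V) (B : Set V) where
  indep : LinearIndependent k (fun b : B => (b : V))
  spans : Submodule.span k B = ⊤
  graded : ∀ b ∈ B, ∃ μ : P, b ∈ S.weight μ
  /-- the structure map `𝐟_{il}` -/
  F : I × ℕ+ → V → V
  F_zero : ∀ il : I × ℕ+, F il 0 = 0
  F_mem : ∀ il : I × ℕ+, ∀ b ∈ B, F il b ∈ B ∪ {0}
  F_approx : ∀ il : I × ℕ+, ∀ b ∈ B, ∃ c : kˣ,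
    S.f il b - (c : k) • F il b ∈ LinearMap.range (S.f il ^ (S.d il b + 2))
  F_inj : ∀ b ∈ B, ∀ b' ∈ B, (∀ il : I × ℕ+, F il b = F il b') → b = b'

namespace WeakLowerPerfectSpace

variable {k I P V : Type*} [Field k] [AddCommGroup P] [AddCommGroup V] [Module k V]

/-- The subspace `Σ_{(i,l) ∈ I^∞} f_{il} V`. -/
noncomputable def rad (S : WeakLowerPerfectSpace k I P V) : Submodule k V :=
  ⨆ il : I × ℕ+, LinearMap.range (S.f il)

/-- The highest core `B_H = {b ∈ B | d_{il}(b) = 0 for all (i,l) ∈ I^∞}`. -/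
def highestCore (S : WeakLowerPerfectSpace k I P V) (B : Set V) : Set V :=
  {b | b ∈ B ∧ ∀ il : I × ℕ+, S.d il b = 0}

end WeakLowerPerfectSpace

namespace WeakLowerPerfectSpace

variable {k I P V : Type*} [Field k] [AddCommGroup P] [AddCommGroup V] [Module k V]
  (S : WeakLowerPerfectSpace k I P V)

theorem exists_weight_projection :
    ∃ π : P → V →ₗ[k] V, (∀ μ, ∀ v ∈ S.weight μ, π μ v = v) ∧
      (∀ μ ν, ∀ v ∈ S.weight μ, μ ≠ ν → π ν v = 0) := by
  classical
  let hd : DirectSum.Decomposition S.weight :=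
    (DirectSum.isInternal_submodule_of_iSupIndep_of_iSup_eq_top
      S.weight_indep S.weight_sup).chooseDecomposition
  refine ⟨fun ν => (S.weight ν).subtype ∘ₗ DirectSum.component k P _ ν ∘ₗ
    (DirectSum.decomposeLinearEquiv S.weight).toLinearMap, ?_, ?_⟩
  · intro μ v hv
    exact DirectSum.decompose_of_mem_same S.weight hv
  · intro μ ν v hv h
    exact DirectSum.decompose_of_mem_ne S.weight hv h

theorem exists_nonneg_of_mem_closure_range {ι M : Type*} [AddCommGroup M] {α : ι → M} {x : M}
    (hx : x ∈ AddSubmonoid.closure (Set.range α)) :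
    ∃ c : ι →₀ ℤ, (∀ i, 0 ≤ c i) ∧ Finsupp.linearCombination ℤ α c = x := by
  induction hx using AddSubmonoid.closure_induction with
  | mem x hx =>
    obtain ⟨i, rfl⟩ := hx
    refine ⟨Finsupp.single i 1, fun j => ?_, by simp⟩
    exact (Finsupp.single_nonneg.2 zero_le_one : (0 : ι →₀ ℤ) ≤ Finsupp.single i 1) j
  | zero => exact ⟨0, by simp, by simp⟩
  | add x y _ _ hx hy =>
    obtain ⟨c, hc, rfl⟩ := hx
    obtain ⟨c', hc', rfl⟩ := hy
    exact ⟨c + c', fun i => add_nonneg (hc i) (hc' i), by simp⟩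

theorem exists_forall_sub_notMem_closure (i : I) (l : ℕ+) (ξ : P) :
    ∃ N : ℕ, ∀ n ≥ N,
      ξ - n • (l : ℕ) • S.alpha i ∉ AddSubmonoid.closure (Set.range S.alpha) := by
  by_cases h : ∃ m : ℕ, ξ - m • (l : ℕ) • S.alpha i ∈ AddSubmonoid.closure (Set.range S.alpha)
  · obtain ⟨m, hm⟩ := h
    obtain ⟨c, -, hc⟩ := exists_nonneg_of_mem_closure_range hm
    refine ⟨m + (c i).natAbs + 1, fun n hn hmem => ?_⟩
    obtain ⟨c', hc'0, hc'⟩ := exists_nonneg_of_mem_closure_range hmem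
    have key : c = c' + Finsupp.single i (((n : ℤ) - m) * (l : ℕ)) := by
      apply S.alpha_indep
      rw [map_add, hc, hc', Finsupp.linearCombination_single, mul_smul, sub_smul]
      simp only [natCast_zsmul]
      abel
    have hi := DFunLike.congr_fun key i
    simp only [Finsupp.add_apply, Finsupp.single_eq_same] at hi
    have hl : (1 : ℤ) ≤ ((l : ℕ) : ℤ) := by exact_mod_cast l.pos
    have h0 := hc'0 i
    have hn' : (m : ℤ) + |c i| + 1 ≤ n := by
      rw [Int.abs_eq_natAbs]
      exact_mod_cast hn
    nlinarith [le_abs_self (c i), abs_nonneg (c i)]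
  · exact ⟨0, fun n _ hn => h ⟨n, hn⟩⟩

theorem exists_weight_eq_bot (i : I) (l : ℕ+) (ν : P) :
    ∃ N : ℕ, ∀ n ≥ N, S.weight (ν + n • (l : ℕ) • S.alpha i) = ⊥ := by
  obtain ⟨s, hs⟩ := S.support_bounded
  choose N hN using fun lam => S.exists_forall_sub_notMem_closure i l (lam - ν)
  refine ⟨s.sup N, fun n hn => ?_⟩
  by_contra hne
  obtain ⟨lam, hlam, hmem⟩ := hs _ hne
  rw [← sub_sub] at hmem
  exact hN lam n ((Finset.le_sup hlam).trans hn) hmem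

theorem pow_f_mem_weight (i : I) (l : ℕ+) (n : ℕ) {μ : P} {v : V} (hv : v ∈ S.weight μ) :
    (S.f (i, l) ^ n) v ∈ S.weight (μ - n • (l : ℕ) • S.alpha i) := by
  induction n with
  | zero => simpa using hv
  | succ n ih =>
    rw [pow_succ', Module.End.mul_apply, succ_nsmul, ← sub_sub]
    exact S.f_weight i l _ (Submodule.mem_map_of_mem ih)

theorem projection_pow_f {π : P → V →ₗ[k] V} (h1 : ∀ μ, ∀ v ∈ S.weight μ, π μ v = v)
    (h2 : ∀ μ ν, ∀ v ∈ S.weight μ, μ ≠ ν → π ν v = 0) (i : I) (l : ℕ+) (n : ℕ) (ν : P) (u : V) :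
    π ν ((S.f (i, l) ^ n) u) = (S.f (i, l) ^ n) (π (ν + n • (l : ℕ) • S.alpha i) u) := by
  have hu : u ∈ ⨆ μ, S.weight μ := S.weight_sup ▸ Submodule.mem_top
  induction hu using Submodule.iSup_induction' with
  | mem μ x hx =>
    by_cases h : μ = ν + n • (l : ℕ) • S.alpha i
    · subst h
      have := S.pow_f_mem_weight i l n hx
      rw [add_sub_cancel_right] at this
      rw [h1 _ _ this, h1 _ _ hx]
    · rw [h2 _ _ _ hx h, h2 _ _ _ (S.pow_f_mem_weight i l n hx), map_zero]
      intro h'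
      exact h (sub_eq_iff_eq_add.1 h')
  | zero => simp
  | add x y _ _ hx hy => simp only [map_add, hx, hy]

theorem exists_projection_pow_f_eq_zero {π : P → V →ₗ[k] V}
    (h1 : ∀ μ, ∀ v ∈ S.weight μ, π μ v = v)
    (h2 : ∀ μ ν, ∀ v ∈ S.weight μ, μ ≠ ν → π ν v = 0) (il : I × ℕ+) (ν : P) :
    ∃ N : ℕ, ∀ n ≥ N, ∀ u, π ν ((S.f il ^ n) u) = 0 := by
  obtain ⟨i, l⟩ := il
  obtain ⟨N, hN⟩ := S.exists_weight_eq_bot i l ν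
  refine ⟨N, fun n hn u => ?_⟩
  rw [S.projection_pow_f h1 h2]
  suffices π (ν + n • (l : ℕ) • S.alpha i) u = 0 by rw [this, map_zero]
  have hu : u ∈ ⨆ μ, S.weight μ := S.weight_sup ▸ Submodule.mem_top
  induction hu using Submodule.iSup_induction' with
  | mem μ x hx =>
    by_cases h : μ = ν + n • (l : ℕ) • S.alpha i
    · subst h
      rw [hN n hn, Submodule.mem_bot] at hx
      rw [hx, map_zero]
    · exact h2 _ _ _ hx h
  | zero => simp
  | add x y _ _ hx hy => rw [map_add, hx, hy, add_zero]

theorem bddAbove_pow_range {μ : P} {v : V} (hv : v ∈ S.weight μ) (hv0 : v ≠ 0) (il : I × ℕ+) :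
    BddAbove {n : ℕ | v ∈ LinearMap.range (S.f il ^ n)} := by
  obtain ⟨π, h1, h2⟩ := S.exists_weight_projection
  obtain ⟨N, hN⟩ := S.exists_projection_pow_f_eq_zero h1 h2 il μ
  refine ⟨N, fun n hn => ?_⟩
  by_contra! hlt
  obtain ⟨u, rfl⟩ := hn
  exact hv0 ((h1 _ _ hv).symm.trans (hN n hlt.le u))

theorem range_pow_antitone (il : I × ℕ+) :
    Antitone fun n : ℕ => LinearMap.range (S.f il ^ n) := by
  refine antitone_nat_of_succ_le fun n => ?_
  rw [pow_succ]
  exact LinearMap.range_comp_le_range _ _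

end WeakLowerPerfectSpace

namespace LowerPerfectBasis

variable {k I P V : Type*} [Field k] [AddCommGroup P] [AddCommGroup V] [Module k V]
  {S : WeakLowerPerfectSpace k I P V} {B : Set V}

theorem ne_zero (LB : LowerPerfectBasis S B) {b : V} (hb : b ∈ B) : b ≠ 0 :=
  LB.indep.ne_zero ⟨b, hb⟩

theorem le_d (LB : LowerPerfectBasis S B) {b : V} (hb : b ∈ B) {il : I × ℕ+} {n : ℕ}
    (h : b ∈ LinearMap.range (S.f il ^ n)) : n ≤ S.d il b := by
  obtain ⟨μ, hμ⟩ := LB.graded b hb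
  exact le_csSup (S.bddAbove_pow_range hμ (LB.ne_zero hb) il) h

theorem mem_range_pow_d (LB : LowerPerfectBasis S B) {b : V} (hb : b ∈ B) (il : I × ℕ+) :
    b ∈ LinearMap.range (S.f il ^ S.d il b) := by
  obtain ⟨μ, hμ⟩ := LB.graded b hb
  exact Nat.sSup_mem (s := {n : ℕ | b ∈ LinearMap.range (S.f il ^ n)}) ⟨0, by simp⟩
    (S.bddAbove_pow_range hμ (LB.ne_zero hb) il)

theorem range_pow_le_sup_succ (LB : LowerPerfectBasis S B) (il : I × ℕ+) (n : ℕ) :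
    LinearMap.range (S.f il ^ n) ≤
      Submodule.span k (B ∩ LinearMap.range (S.f il ^ n)) ⊔ LinearMap.range (S.f il ^ (n + 1)) := by
  induction n with
  | zero =>
    have : B ∩ (LinearMap.range (S.f il ^ 0) : Set V) = B := by
      ext x
      simp
    rw [this, LB.spans]
    simp
  | succ n ih =>
    have hrange (m : ℕ) :
        LinearMap.range (S.f il ^ (m + 1)) = (LinearMap.range (S.f il ^ m)).map (S.f il) := by
      rw [pow_succ', Module.End.mul_eq_comp, LinearMap.range_comp]
    rw [hrange n]
    refine (Submodule.map_mono ih).trans ?_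
    rw [Submodule.map_sup, ← hrange, ← hrange]
    refine sup_le ?_ le_sup_right
    rw [Submodule.map_span, Submodule.span_le]
    rintro _ ⟨b, ⟨hb, hbn⟩, rfl⟩
    have hd : n ≤ S.d il b := LB.le_d hb hbn
    obtain ⟨c, hc⟩ := LB.F_approx il b hb
    have hfb : S.f il b ∈ LinearMap.range (S.f il ^ (S.d il b + 1)) := by
      rw [hrange]
      exact Submodule.mem_map_of_mem (LB.mem_range_pow_d hb il)
    have hcF : (c : k) • LB.F il b ∈ LinearMap.range (S.f il ^ (S.d il b + 1)) := by
      have := Submodule.sub_mem _ hfb (S.range_pow_antitone il (Nat.le_succ _) hc)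
      simpa using this
    have hF : LB.F il b ∈ LinearMap.range (S.f il ^ (n + 1)) :=
      S.range_pow_antitone il (Nat.succ_le_succ hd)
        ((Submodule.smul_mem_iff _ c.ne_zero).1 hcF)
    rw [← sub_add_cancel (S.f il b) ((c : k) • LB.F il b),
      add_comm (S.f il b - _)]
    refine Submodule.add_mem_sup (Submodule.smul_mem _ _ ?_)
      (S.range_pow_antitone il (Nat.add_le_add_right hd 2) hc)
    rcases LB.F_mem il b hb with hmem | h0
    · exact Submodule.subset_span ⟨hmem, hF⟩
    · rw [Set.mem_singleton_iff.1 h0]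
      exact Submodule.zero_mem _

theorem range_pow_le_sup (LB : LowerPerfectBasis S B) (il : I × ℕ+) (n m : ℕ) :
    LinearMap.range (S.f il ^ n) ≤
      Submodule.span k (B ∩ LinearMap.range (S.f il ^ n)) ⊔ LinearMap.range (S.f il ^ (n + m)) := by
  induction m with
  | zero => exact le_sup_right
  | succ m ih =>
    refine ih.trans (sup_le le_sup_left ((LB.range_pow_le_sup_succ il (n + m)).trans ?_))
    refine sup_le_sup_right (Submodule.span_mono (Set.inter_subset_inter_right _ ?_)) _
    exact S.range_pow_antitone il (Nat.le_add_right n m)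

/-- The image of `f_{il}^n` is spanned by the basis elements it contains. -/
theorem range_pow_le_span (LB : LowerPerfectBasis S B) (il : I × ℕ+) (n : ℕ) :
    LinearMap.range (S.f il ^ n) ≤ Submodule.span k (B ∩ LinearMap.range (S.f il ^ n)) := by
  obtain ⟨π, h1, h2⟩ := S.exists_weight_projection
  rintro _ ⟨u, rfl⟩
  have hu : u ∈ ⨆ μ, S.weight μ := S.weight_sup ▸ Submodule.mem_top
  induction hu using Submodule.iSup_induction' with
  | mem μ x hx =>
    obtain ⟨i, l⟩ := il
    have hν := S.pow_f_mem_weight i l n hx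
    set ν := μ - n • (l : ℕ) • S.alpha i
    obtain ⟨N, hN⟩ := S.exists_projection_pow_f_eq_zero h1 h2 (i, l) ν
    obtain ⟨w, hw, _, ⟨y, rfl⟩, hwz⟩ :=
      Submodule.mem_sup.1 (LB.range_pow_le_sup (i, l) n N ⟨x, rfl⟩)
    have hπ : (S.f (i, l) ^ n) x = π ν w := by
      rw [← h1 _ _ hν, ← hwz, map_add, hN _ (Nat.le_add_left N n), add_zero]
    rw [hπ]
    refine (Submodule.span_le (p := (Submodule.span k _).comap (π ν))).2 ?_ hw
    rintro b ⟨hb, hbn⟩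
    obtain ⟨ξ, hξ⟩ := LB.graded b hb
    by_cases h : ξ = ν
    · subst h
      rw [SetLike.mem_coe, Submodule.mem_comap, h1 _ _ hξ]
      exact Submodule.subset_span ⟨hb, hbn⟩
    · simp only [SetLike.mem_coe, Submodule.mem_comap, h2 _ _ _ hξ h, Submodule.zero_mem]
  | zero => simp
  | add x y _ _ hx hy =>
    rw [map_add]
    exact Submodule.add_mem _ hx hy

theorem rad_le_span (LB : LowerPerfectBasis S B) :
    S.rad ≤ Submodule.span k (B \ S.highestCore B) := by
  refine iSup_le fun il => ?_
  have h := LB.range_pow_le_span il 1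
  simp only [pow_one] at h
  refine h.trans (Submodule.span_mono ?_)
  rintro b ⟨hb, hbf⟩
  refine ⟨hb, fun hcore => ?_⟩
  have := LB.le_d (n := 1) hb (by simpa using hbf)
  rw [hcore.2 il] at this
  omega

end LowerPerfectBasis

theorem stmt_12 {k I P V : Type*} [Field k] [AddCommGroup P] [AddCommGroup V] [Module k V]
    (S : WeakLowerPerfectSpace k I P V) (B : Set V) (LB : LowerPerfectBasis S B) :
    Set.InjOn ⇑S.rad.mkQ (S.highestCore B) := by
  intro b hb b' hb' h
  by_contra hne
  have hsub : b - b' ∈ S.rad := (Submodule.Quotient.eq _).1 h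
  have hmem : b ∈ Submodule.span k (B \ {b}) := by
    have hb'span : b' ∈ Submodule.span k (B \ {b}) :=
      Submodule.subset_span ⟨hb'.1, fun e => hne e.symm⟩
    refine (Submodule.sub_mem_iff_left _ hb'span).1 (Submodule.span_mono ?_ (LB.rad_le_span hsub))
    rintro x ⟨hx, hxc⟩
    exact ⟨hx, fun e => hxc (Set.mem_singleton_iff.1 e ▸ hb)⟩
  have himage : B \ {b} = (fun x : B => (x : V)) '' {x | x ≠ ⟨b, hb.1⟩} := by
    ext x
    simp [Subtype.ext_iff, and_comm]
  rw [himage] at hmem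
  exact LB.indep.notMem_span_image (x := ⟨b, hb.1⟩) (by simp) hmem
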